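/- Let S(ρ) = ∑_{μ∈F} K_μ ρ K_μ^† be a trace-preserving Kraus-form map on complex matrices indexed by Fin n ⊕ Fin m satisfying: (i) P_A S(ρ) P_A = S(ρ) for all ρ, and (ii) there is an n×n unitary U_A with S(ρ) equal to the block embedding of U_A ρ_A U_A^† whenever P_A ρ P_A = ρ. Then for every unit vector ψ with components ψ_A ∈ ℂ^n and ψ_Ā ∈ ℂ^m, S(ψ ψ^†) equals the block embedding of ‖ψ_A‖²·(U_A w)(U_A w)^† plus S applied to the block embedding of ψ_Ā ψ_Ā^†, where w = ψ_A/‖ψ_A‖ when ψ_A ≠ 0 (and the first summand is 0 when ψ_A = 0); i.e. the output state is the probabilistic mixture, with weights ‖ψ_A‖² and ‖ψ_Ā‖², of the two states obtained from the measurement-based protocol. -/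

import Mathlib

open Matrix BigOperators

/-- The orthogonal projection onto the first (`A`) block. -/
noncomputable def projA (n m : ℕ) : Matrix (Fin n ⊕ Fin m) (Fin n ⊕ Fin m) ℂ :=
  Matrix.fromBlocks 1 0 0 0

/-- The Euclidean norm of a finite complex vector. -/
noncomputable def evNorm {k : ℕ} (v : Fin k → ℂ) : ℝ :=
  Real.sqrt ((star v ⬝ᵥ v).re)

/-- A finite sum of matrices `X Xᴴ` vanishes only if every `X` does. -/
theorem eq_zero_of_sum_mul_conjTranspose_eq_zero {ι κ F : Type*} [Fintype ι] [Fintype κ]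
    [Fintype F] (X : F → Matrix ι κ ℂ) (h : ∑ μ, X μ * (X μ)ᴴ = 0) (μ : F) : X μ = 0 := by
  ext i j
  have hi : ∑ ν, ∑ l, ‖X ν i l‖ ^ 2 = 0 := by
    have h' := congrFun (congrFun h i) i
    simp only [Matrix.sum_apply, Matrix.mul_apply, Matrix.conjTranspose_apply, RCLike.star_def,
      Complex.mul_conj', Matrix.zero_apply] at h'
    exact_mod_cast h'
  rw [Finset.sum_eq_zero_iff_of_nonneg fun _ _ => by positivity] at hi
  have hμ := hi μ (Finset.mem_univ μ)
  rw [Finset.sum_eq_zero_iff_of_nonneg fun _ _ => by positivity] at hμ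
  simpa using hμ j (Finset.mem_univ j)

/-- The Kraus operators of the identity channel are scalar. -/
theorem exists_eq_smul_one_of_sum_conj_eq {ι F : Type*} [Fintype ι] [DecidableEq ι] [Fintype F]
    (V : F → Matrix ι ι ℂ) (hV : ∀ ρ, ∑ μ, V μ * ρ * (V μ)ᴴ = ρ) (μ : F) :
    ∃ c : ℂ, V μ = c • (1 : Matrix ι ι ℂ) := by
  have hcomm : ∀ ρ, V μ * ρ - ρ * V μ = 0 := fun ρ => by
    refine eq_zero_of_sum_mul_conjTranspose_eq_zero (fun ν => V ν * ρ - ρ * V ν) ?_ μ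
    calc ∑ ν, (V ν * ρ - ρ * V ν) * (V ν * ρ - ρ * V ν)ᴴ
        = ∑ ν, V ν * (ρ * ρᴴ) * (V ν)ᴴ - (∑ ν, V ν * ρ * (V ν)ᴴ) * ρᴴ
            - ρ * (∑ ν, V ν * ρᴴ * (V ν)ᴴ) + ρ * (∑ ν, V ν * 1 * (V ν)ᴴ) * ρᴴ := by
          simp only [Finset.sum_mul, Finset.mul_sum, ← Finset.sum_sub_distrib,
            ← Finset.sum_add_distrib]
          refine Finset.sum_congr rfl fun ν _ => ?_
          simp only [Matrix.conjTranspose_sub, Matrix.conjTranspose_mul]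
          noncomm_ring
      _ = 0 := by simp only [hV]; noncomm_ring
  obtain ⟨c, hc⟩ := Matrix.mem_range_scalar_of_commute_single (M := V μ)
    fun i j _ => (sub_eq_zero.mp (hcomm (Matrix.single i j 1))).symm
  exact ⟨c, by rw [← hc, Matrix.scalar_apply, Matrix.smul_one_eq_diagonal]⟩

/-- If the Kraus operators with blocks `a μ`, `b μ` in the first row satisfy the off-diagonal
trace-preservation condition and the `a μ` implement conjugation by a unitary `U`, then
coherences between the two blocks are annihilated. -/
theorem sum_mul_mul_conjTranspose_eq_zero {ι κ F : Type*} [Fintype ι] [DecidableEq ι]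
    [Fintype κ] [Fintype F] (a : F → Matrix ι ι ℂ) (b : F → Matrix ι κ ℂ)
    (U : Matrix ι ι ℂ) (hU : U ∈ Matrix.unitaryGroup ι ℂ)
    (ha : ∀ ρ, ∑ μ, a μ * ρ * (a μ)ᴴ = U * ρ * Uᴴ) (hab : ∑ μ, (a μ)ᴴ * b μ = 0)
    (C : Matrix ι κ ℂ) : ∑ μ, a μ * C * (b μ)ᴴ = 0 := by
  have hU₁ : Uᴴ * U = 1 := Matrix.mem_unitaryGroup_iff'.mp hU
  have hU₂ : U * Uᴴ = 1 := Matrix.mem_unitaryGroup_iff.mp hU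
  have hV : ∀ ρ, ∑ μ, (Uᴴ * a μ) * ρ * (Uᴴ * a μ)ᴴ = ρ := fun ρ => by
    calc ∑ μ, (Uᴴ * a μ) * ρ * (Uᴴ * a μ)ᴴ = Uᴴ * (∑ μ, a μ * ρ * (a μ)ᴴ) * U := by
          simp [Finset.sum_mul, Finset.mul_sum, Matrix.mul_assoc]
      _ = (Uᴴ * U) * ρ * (Uᴴ * U) := by rw [ha]; simp only [Matrix.mul_assoc]
      _ = ρ := by simp [hU₁]
  choose c hc using exists_eq_smul_one_of_sum_conj_eq _ hV
  have haU : ∀ μ, a μ = c μ • U := fun μ => by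
    rw [← Matrix.one_mul (a μ), ← hU₂, Matrix.mul_assoc, hc]
    simp
  have hb : ∑ μ, c μ • (b μ)ᴴ = 0 := by
    have h := congrArg (fun M => (U * M)ᴴ) hab
    simpa [haU, Matrix.mul_sum, Matrix.conjTranspose_sum, Matrix.mul_assoc, hU₂] using h
  calc ∑ μ, a μ * C * (b μ)ᴴ = U * C * ∑ μ, c μ • (b μ)ᴴ := by
        simp [haU, Matrix.mul_sum]
    _ = 0 := by rw [hb, Matrix.mul_zero]

/-- A sum of block matrices is the block matrix of the sums. -/
theorem sum_fromBlocks_eq {ι κ F R : Type*} [Fintype F] [AddCommMonoid R]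
    (a : F → Matrix ι ι R) (b : F → Matrix ι κ R) (c : F → Matrix κ ι R) (d : F → Matrix κ κ R) :
    ∑ μ, Matrix.fromBlocks (a μ) (b μ) (c μ) (d μ)
      = Matrix.fromBlocks (∑ μ, a μ) (∑ μ, b μ) (∑ μ, c μ) (∑ μ, d μ) := by
  ext (i | i) (j | j) <;> simp [Matrix.sum_apply]

/-- The rank-one matrix of a vector, split into its diagonal and off-diagonal blocks. -/
theorem vecMulVec_star_eq_add_fromBlocks {ι κ : Type*} (ψ : ι ⊕ κ → ℂ) :
    Matrix.vecMulVec ψ (star ψ)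
      = Matrix.fromBlocks (Matrix.vecMulVec (ψ ∘ Sum.inl) (star (ψ ∘ Sum.inl))) 0 0 0
        + Matrix.fromBlocks 0 (Matrix.vecMulVec (ψ ∘ Sum.inl) (star (ψ ∘ Sum.inr)))
            (Matrix.vecMulVec (ψ ∘ Sum.inl) (star (ψ ∘ Sum.inr)))ᴴ 0
        + Matrix.fromBlocks 0 0 0 (Matrix.vecMulVec (ψ ∘ Sum.inr) (star (ψ ∘ Sum.inr))) := by
  ext (i | i) (j | j) <;> simp [Matrix.vecMulVec_apply]

open scoped ComplexOrder in
theorem evNorm_ne_zero {k : ℕ} {v : Fin k → ℂ} (hv : v ≠ 0) : evNorm v ≠ 0 := by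
  have h : 0 < star v ⬝ᵥ v := Matrix.dotProduct_star_self_pos_iff.mpr hv
  exact (Real.sqrt_pos.mpr (Complex.pos_iff.mp h).1).ne'

/-- The scalar weight undoes the normalization of a rank-one matrix. -/
theorem sq_smul_vecMulVec_mulVec_inv_smul {ι : Type*} [Fintype ι] (U : Matrix ι ι ℂ) (v : ι → ℂ)
    {r : ℝ} (hr : r ≠ 0) :
    ((r ^ 2 : ℝ) : ℂ) • Matrix.vecMulVec (U *ᵥ ((r : ℂ)⁻¹ • v)) (star (U *ᵥ ((r : ℂ)⁻¹ • v)))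
      = U * Matrix.vecMulVec v (star v) * Uᴴ := by
  have hr' : (r : ℂ) ≠ 0 := by exact_mod_cast hr
  rw [Matrix.mul_vecMulVec, Matrix.vecMulVec_mul, ← Matrix.star_mulVec, Matrix.mulVec_smul]
  ext i j
  simp only [Matrix.smul_apply, Matrix.vecMulVec_apply, Pi.smul_apply, Pi.star_apply, smul_eq_mul,
    star_mul', star_inv₀, RCLike.star_def, Complex.conj_ofReal]
  push_cast
  field_simp

/-- the output on a pure input `ψψᴴ` is the mixture, with
weights `‖ψ_A‖²` and `‖ψ_Ā‖²`, of the two states produced by the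
measurement-based protocol: the block embedding of
`‖ψ_A‖²·(U_A w)(U_A w)ᴴ` (with `w = ψ_A/‖ψ_A‖`, the summand being `0` when
`ψ_A = 0`) plus `S` applied to the block embedding of `ψ_Ā ψ_Āᴴ`. -/
theorem dfs_channel_output_is_mixture {n m : ℕ} {F : Type*} [Fintype F]
    (K : F → Matrix (Fin n ⊕ Fin m) (Fin n ⊕ Fin m) ℂ)
    (S : Matrix (Fin n ⊕ Fin m) (Fin n ⊕ Fin m) ℂ →
         Matrix (Fin n ⊕ Fin m) (Fin n ⊕ Fin m) ℂ)
    (hS : ∀ ρ, S ρ = ∑ μ, K μ * ρ * (K μ)ᴴ)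
    (htp : ∑ μ, (K μ)ᴴ * K μ = 1)
    (hsupp : ∀ ρ, projA n m * S ρ * projA n m = S ρ)
    (UA : Matrix (Fin n) (Fin n) ℂ)
    (hUA : UA ∈ Matrix.unitaryGroup (Fin n) ℂ)
    (hdfs : ∀ ρ : Matrix (Fin n ⊕ Fin m) (Fin n ⊕ Fin m) ℂ,
      projA n m * ρ * projA n m = ρ →
      S ρ = Matrix.fromBlocks (UA * ρ.toBlocks₁₁ * UAᴴ) 0 0 0) :
    ∀ ψ : Fin n ⊕ Fin m → ℂ, star ψ ⬝ᵥ ψ = 1 →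
      (ψ ∘ Sum.inl ≠ 0 →
        S (Matrix.vecMulVec ψ (star ψ)) =
          Matrix.fromBlocks
            (((evNorm (ψ ∘ Sum.inl) ^ 2 : ℝ) : ℂ) •
              Matrix.vecMulVec
                (UA *ᵥ (((evNorm (ψ ∘ Sum.inl) : ℝ) : ℂ)⁻¹ • (ψ ∘ Sum.inl)))
                (star (UA *ᵥ (((evNorm (ψ ∘ Sum.inl) : ℝ) : ℂ)⁻¹ • (ψ ∘ Sum.inl)))))
            0 0 0 +
          S (Matrix.fromBlocks 0 0 0
              (Matrix.vecMulVec (ψ ∘ Sum.inr) (star (ψ ∘ Sum.inr))))) ∧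
      (ψ ∘ Sum.inl = 0 →
        S (Matrix.vecMulVec ψ (star ψ)) =
          (0 : Matrix (Fin n ⊕ Fin m) (Fin n ⊕ Fin m) ℂ) +
          S (Matrix.fromBlocks 0 0 0
              (Matrix.vecMulVec (ψ ∘ Sum.inr) (star (ψ ∘ Sum.inr))))) := by
  intro ψ _
  have hadd : ∀ ρ σ, S (ρ + σ) = S ρ + S σ := fun ρ σ => by
    simp only [hS, Matrix.mul_add, Matrix.add_mul, Finset.sum_add_distrib]
  let a μ := (K μ).toBlocks₁₁
  let b μ := (K μ).toBlocks₁₂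
  have hlower : ∀ μ, (K μ).toBlocks₂₁ = 0 ∧ (K μ).toBlocks₂₂ = 0 := by
    let Q : Matrix (Fin n ⊕ Fin m) (Fin n ⊕ Fin m) ℂ := Matrix.fromBlocks 0 0 0 1
    have hQ : Q * projA n m = 0 := by simp [Q, projA, Matrix.fromBlocks_multiply]
    have hz : ∑ μ, (Q * K μ) * (Q * K μ)ᴴ = 0 := by
      calc ∑ μ, (Q * K μ) * (Q * K μ)ᴴ = Q * S 1 * Qᴴ := by
            simp [hS, Matrix.sum_mul, Matrix.mul_sum, Matrix.mul_assoc]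
        _ = (Q * projA n m) * S 1 * projA n m * Qᴴ := by
            conv_lhs => rw [← hsupp]
            simp only [Matrix.mul_assoc]
        _ = 0 := by simp [hQ]
    intro μ
    have hμ := eq_zero_of_sum_mul_conjTranspose_eq_zero _ hz μ
    rw [← Matrix.fromBlocks_toBlocks (K μ), Matrix.fromBlocks_multiply, ← Matrix.fromBlocks_zero,
      Matrix.fromBlocks_inj] at hμ
    simpa using hμ.2.2
  have hK : ∀ μ, K μ = Matrix.fromBlocks (a μ) (b μ) 0 0 := fun μ => by
    conv_lhs => rw [← Matrix.fromBlocks_toBlocks (K μ), (hlower μ).1, (hlower μ).2]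
  have hA : ∀ ρ, S (Matrix.fromBlocks ρ 0 0 0) = Matrix.fromBlocks (UA * ρ * UAᴴ) 0 0 0 :=
    fun ρ => by
      rw [hdfs _ (by simp [projA, Matrix.fromBlocks_multiply]), Matrix.toBlocks_fromBlocks₁₁]
  have ha : ∀ ρ, ∑ μ, a μ * ρ * (a μ)ᴴ = UA * ρ * UAᴴ := fun ρ => by
    have h := hA ρ
    simp only [hS, hK, Matrix.fromBlocks_conjTranspose, Matrix.fromBlocks_multiply,
      sum_fromBlocks_eq, Matrix.fromBlocks_inj] at h
    simpa using h.1
  have hab : ∑ μ, (a μ)ᴴ * b μ = 0 := by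
    have h := htp
    simp only [hK, Matrix.fromBlocks_conjTranspose, Matrix.fromBlocks_multiply,
      sum_fromBlocks_eq, ← Matrix.fromBlocks_one, Matrix.fromBlocks_inj] at h
    simpa using h.2.1
  have hoff : ∀ C : Matrix (Fin n) (Fin m) ℂ, S (Matrix.fromBlocks 0 C Cᴴ 0) = 0 := fun C => by
    have h₁ := sum_mul_mul_conjTranspose_eq_zero a b UA hUA ha hab C
    have h₂ : ∑ μ, b μ * Cᴴ * (a μ)ᴴ = 0 := by
      simpa [Matrix.conjTranspose_sum, Matrix.mul_assoc] using congrArg Matrix.conjTranspose h₁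
    simp [hS, hK, Matrix.fromBlocks_conjTranspose, Matrix.fromBlocks_multiply,
      sum_fromBlocks_eq, Finset.sum_add_distrib, h₁, h₂]
  have hsplit : S (Matrix.vecMulVec ψ (star ψ)) =
      Matrix.fromBlocks
        (UA * Matrix.vecMulVec (ψ ∘ Sum.inl) (star (ψ ∘ Sum.inl)) * UAᴴ) 0 0 0 +
      S (Matrix.fromBlocks 0 0 0
        (Matrix.vecMulVec (ψ ∘ Sum.inr) (star (ψ ∘ Sum.inr)))) := by
    rw [vecMulVec_star_eq_add_fromBlocks ψ, hadd, hadd, hA, hoff, add_zero]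
  refine ⟨fun hψ => ?_, fun hψ => ?_⟩
  · rw [hsplit, sq_smul_vecMulVec_mulVec_inv_smul UA _ (evNorm_ne_zero hψ)]
  · rw [hsplit, hψ]
    simp
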